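/- Fix m_max ≥ 1. For each n ≥ 2, let m_n and m'_n be integers with 1 ≤ m_n ≤ m_max and 1 ≤ m'_n ≤ m_max, let u_{n,1}, …, u_{n,m_n} and u'_{n,1}, …, u'_{n,m'_n} be integers in {1, …, n}, and let r_n, s_n > 0 with r_n/n → A and s_n/n → B as n → ∞, where 0 < A < B. Define the LCUBE scores Δ_n = log m_n + Σ_{j=1}^{m_n} log u_{n,j} + ((m_n + 4)/2)·log n + (n/2)·log(r_n/n) and Δ'_n = log m'_n + Σ_{j=1}^{m'_n} log u'_{n,j} + ((m'_n + 4)/2)·log n + (n/2)·log(s_n/n). Then there exists N such that for all n ≥ N, Δ_n < Δ'_n. -/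

import Mathlib

open Filter Topology

/-- The LCUBE two-part MDL score
`Δₙ = log mₙ + Σⱼ log uₙⱼ + ((mₙ+4)/2)·log n + (n/2)·log(rₙ/n)`
of the direction with smaller asymptotic mean residual sum of squares is eventually
strictly smaller, when the numbers of knots are bounded by `m_max` and the knot-interval
counts `uₙⱼ, u'ₙⱼ` lie in `{1, …, n}`. -/
theorem stmt_2 (mmax : ℕ) (hmmax : 1 ≤ mmax)
    (m m' : ℕ → ℕ)
    (hm : ∀ n : ℕ, 2 ≤ n → 1 ≤ m n ∧ m n ≤ mmax)
    (hm' : ∀ n : ℕ, 2 ≤ n → 1 ≤ m' n ∧ m' n ≤ mmax)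
    (u u' : ℕ → ℕ → ℕ)
    (hu : ∀ n : ℕ, 2 ≤ n → ∀ j ∈ Finset.Icc 1 (m n), 1 ≤ u n j ∧ u n j ≤ n)
    (hu' : ∀ n : ℕ, 2 ≤ n → ∀ j ∈ Finset.Icc 1 (m' n), 1 ≤ u' n j ∧ u' n j ≤ n)
    (r s : ℕ → ℝ) (hr : ∀ n, 0 < r n) (hs : ∀ n, 0 < s n)
    (A B : ℝ) (hA : 0 < A) (hAB : A < B)
    (hrA : Tendsto (fun n : ℕ => r n / n) atTop (𝓝 A))
    (hsB : Tendsto (fun n : ℕ => s n / n) atTop (𝓝 B)) :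
    ∃ N : ℕ, ∀ n : ℕ, N ≤ n →
      Real.log (m n) + (∑ j ∈ Finset.Icc 1 (m n), Real.log (u n j))
        + ((m n : ℝ) + 4) / 2 * Real.log n + (n : ℝ) / 2 * Real.log (r n / n)
      < Real.log (m' n) + (∑ j ∈ Finset.Icc 1 (m' n), Real.log (u' n j))
        + ((m' n : ℝ) + 4) / 2 * Real.log n + (n : ℝ) / 2 * Real.log (s n / n) := by
  have hlog : Tendsto (fun n : ℕ => Real.log n / n) atTop (𝓝 0) :=
    (Real.isLittleO_log_id_atTop.tendsto_div_nhds_zero).comp tendsto_natCast_atTop_atTop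
  have hpenalty : Tendsto (fun n : ℕ => Real.log mmax / n
      + ((mmax : ℝ) + ((mmax : ℝ) + 4) / 2) * (Real.log n / n)) atTop (𝓝 0) := by
    simpa using (tendsto_const_div_atTop_nhds_zero_nat (Real.log mmax)).add
      (hlog.const_mul ((mmax : ℝ) + ((mmax : ℝ) + 4) / 2))
  have hgap : Tendsto (fun n : ℕ => (Real.log (s n / n) - Real.log (r n / n)) / 2) atTop
      (𝓝 ((Real.log B - Real.log A) / 2)) :=
    ((hsB.log (hA.trans hAB).ne').sub (hrA.log hA.ne')).div_const 2
  have hpos : 0 < (Real.log B - Real.log A) / 2 := by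
    linarith [Real.log_lt_log hA hAB]
  obtain ⟨N, hN⟩ := eventually_atTop.mp
    ((hpenalty.eventually_lt hgap hpos).and (eventually_ge_atTop 2))
  refine ⟨N, fun n hn => ?_⟩
  obtain ⟨hlt, hn2⟩ := hN n hn
  obtain ⟨hm1, hm2⟩ := hm n hn2
  have hn0 : (0 : ℝ) < n := by positivity
  have hlogn : 0 ≤ Real.log n := Real.log_natCast_nonneg n
  have hmle : (m n : ℝ) ≤ mmax := by exact_mod_cast hm2
  have hlogm : Real.log (m n) ≤ Real.log mmax :=
    Real.log_le_log (by exact_mod_cast hm1) hmle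
  have hsum : ∑ j ∈ Finset.Icc 1 (m n), Real.log (u n j) ≤ m n * Real.log n := by
    have := Finset.sum_le_card_nsmul (Finset.Icc 1 (m n)) (fun j => Real.log (u n j))
      (Real.log n) fun j hj => Real.log_le_log
        (by exact_mod_cast (hu n hn2 j hj).1) (by exact_mod_cast (hu n hn2 j hj).2)
    simpa using this
  have hmul : m n * Real.log n ≤ mmax * Real.log n := by gcongr
  have hparam : ((m n : ℝ) + 4) / 2 * Real.log n ≤ ((mmax : ℝ) + 4) / 2 * Real.log n := by
    gcongr
  have hlogm' : 0 ≤ Real.log (m' n) := Real.log_natCast_nonneg _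
  have hsum' : 0 ≤ ∑ j ∈ Finset.Icc 1 (m' n), Real.log (u' n j) :=
    Finset.sum_nonneg fun j _ => Real.log_natCast_nonneg _
  have hparam' : 0 ≤ ((m' n : ℝ) + 4) / 2 * Real.log n := by positivity
  have hscaled := mul_lt_mul_of_pos_left hlt hn0
  have hcancel : (n : ℝ) * (Real.log mmax / n
      + ((mmax : ℝ) + ((mmax : ℝ) + 4) / 2) * (Real.log n / n))
      = Real.log mmax + ((mmax : ℝ) + ((mmax : ℝ) + 4) / 2) * Real.log n := by
    field_simp
  rw [hcancel] at hscaled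
  linarith
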